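/- For the real Bohnenblust–Hille constants C, the sequence n ↦ (C_{2n}/C_{2n−1}) / (C_n/C_{n−1})^((n−1)/(2n−1)) (n ranging over integers n ≥ 2) converges to 1 as n → ∞. -/

import Mathlib

open Real Filter

/-- The Khinchine-inequality constant `A_p = √2 · (Γ((p+1)/2)/√π)^(1/p)`. -/
noncomputable def khinchineA (p : ℝ) : ℝ :=
  Real.sqrt 2 * (Real.Gamma ((p + 1) / 2) / Real.sqrt π) ^ (1 / p)

/-- The real Bohnenblust–Hille constants: `C 1 = 1`, `C 2 = √2`, `C 3 = 2^(5/6)`,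
`C m = C (m/2) / A_{2m/(m+2)}^(m/2)` for even `m ≥ 4`, and
`C m = (C ((m−1)/2) / A_{(2m−2)/(m+1)}^((m+1)/2))^((m−1)/(2m)) ·
       (C ((m+1)/2) / A_{(2m+2)/(m+3)}^((m−1)/2))^((m+1)/(2m))` for odd `m ≥ 5`. -/
noncomputable def bhConstR : ℕ → ℝ
  | m =>
    if _h1 : m ≤ 1 then 1
    else if _h2 : m = 2 then Real.sqrt 2
    else if _h3 : m = 3 then (2 : ℝ) ^ ((5 : ℝ) / 6)
    else if _h4 : m % 2 = 0 then
      bhConstR (m / 2) / khinchineA (2 * (m : ℝ) / ((m : ℝ) + 2)) ^ ((m : ℝ) / 2)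
    else
      (bhConstR ((m - 1) / 2) /
          khinchineA ((2 * (m : ℝ) - 2) / ((m : ℝ) + 1)) ^ (((m : ℝ) + 1) / 2)) ^
        (((m : ℝ) - 1) / (2 * (m : ℝ))) *
      (bhConstR ((m + 1) / 2) /
          khinchineA ((2 * (m : ℝ) + 2) / ((m : ℝ) + 3)) ^ (((m : ℝ) - 1) / 2)) ^
        (((m : ℝ) + 1) / (2 * (m : ℝ)))
  termination_by m => m
  decreasing_by all_goals omega

lemma khA_pos {p : ℝ} (hp : 0 < p) : 0 < khinchineA p := by
  unfold khinchineA
  have h1 : 0 < Real.Gamma ((p + 1) / 2) := Real.Gamma_pos_of_pos (by linarith)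
  have h2 : 0 < Real.sqrt π := Real.sqrt_pos.mpr Real.pi_pos
  have h3 : 0 < Real.sqrt 2 := Real.sqrt_pos.mpr (by norm_num)
  exact mul_pos h3 (Real.rpow_pos_of_pos (div_pos h1 h2) _)

lemma khA_two : khinchineA 2 = 1 := by
  unfold khinchineA
  have h1 : Real.Gamma ((2 + 1) / 2 : ℝ) = 1 / 2 * Real.sqrt π := by
    have := Real.Gamma_add_one (s := (1 / 2 : ℝ)) (by norm_num)
    rw [Real.Gamma_one_half_eq] at this
    rw [← this]; norm_num
  have h2 : Real.sqrt π ≠ 0 := (Real.sqrt_pos.mpr Real.pi_pos).ne'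
  rw [h1, mul_div_assoc, div_self h2, mul_one, ← Real.sqrt_eq_rpow,
    ← Real.sqrt_mul (by norm_num)]
  norm_num

lemma khA_diff : DifferentiableAt ℝ (fun p => Real.log (khinchineA p)) 2 := by
  have hG : DifferentiableAt ℝ (fun p : ℝ => Real.Gamma ((p + 1) / 2)) 2 := by
    have h : DifferentiableAt ℝ Real.Gamma ((2 + 1) / 2 : ℝ) := by
      apply Real.differentiableAt_Gamma
      intro m hm
      have : (0 : ℝ) ≤ m := Nat.cast_nonneg m
      linarith
    exact DifferentiableAt.comp (f := fun p : ℝ => (p + 1) / 2) (2 : ℝ) h (by fun_prop)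
  have h1 : 0 < Real.Gamma ((2 + 1) / 2 : ℝ) := Real.Gamma_pos_of_pos (by norm_num)
  have h2 : 0 < Real.sqrt π := Real.sqrt_pos.mpr Real.pi_pos
  refine DifferentiableAt.log ?_ (khA_pos (by norm_num)).ne'
  unfold khinchineA
  refine DifferentiableAt.const_mul ?_ _
  refine DifferentiableAt.rpow (hG.div_const _) ?_ (div_pos h1 h2).ne'
  exact (differentiableAt_const _).div differentiableAt_id (by norm_num)

lemma bh_pos (m : ℕ) : 0 < bhConstR m := by
  induction m using Nat.strong_induction_on with
  | _ m ih =>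
    rw [bhConstR]
    split_ifs with h1 h2 h3 h4
    · norm_num
    · positivity
    · positivity
    · have hm : (0 : ℝ) < m := by exact_mod_cast (by omega : 0 < m)
      exact div_pos (ih _ (by omega)) (Real.rpow_pos_of_pos (khA_pos (by positivity)) _)
    · have hm : (4 : ℝ) ≤ m := by exact_mod_cast (by omega : 4 ≤ m)
      have e1 : 0 < (2 * (m : ℝ) - 2) / ((m : ℝ) + 1) := div_pos (by linarith) (by linarith)
      have e2 : 0 < (2 * (m : ℝ) + 2) / ((m : ℝ) + 3) := div_pos (by linarith) (by linarith)
      refine mul_pos (Real.rpow_pos_of_pos ?_ _) (Real.rpow_pos_of_pos ?_ _)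
      · exact div_pos (ih _ (by omega)) (Real.rpow_pos_of_pos (khA_pos e1) _)
      · exact div_pos (ih _ (by omega)) (Real.rpow_pos_of_pos (khA_pos e2) _)

lemma bh_even (n : ℕ) (hn : 3 ≤ n) :
    bhConstR (2 * n) = bhConstR n / khinchineA (2 * (n : ℝ) / (n + 1)) ^ (n : ℝ) := by
  rw [bhConstR, dif_neg (by omega), dif_neg (by omega), dif_neg (by omega), dif_pos (by omega)]
  have h : 2 * n / 2 = n := by omega
  have h0 : (n : ℝ) + 1 ≠ 0 := by positivity
  have e1 : 2 * ((2 * n : ℕ) : ℝ) / (((2 * n : ℕ) : ℝ) + 2) = 2 * (n : ℝ) / (n + 1) := by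
    push_cast; field_simp
  have e2 : ((2 * n : ℕ) : ℝ) / 2 = n := by push_cast; ring
  rw [h, e1, e2]

lemma bh_odd (n : ℕ) (hn : 3 ≤ n) :
    bhConstR (2 * n - 1) =
      (bhConstR (n - 1) / khinchineA ((2 * (n : ℝ) - 2) / n) ^ (n : ℝ)) ^
        (((n : ℝ) - 1) / (2 * n - 1)) *
      (bhConstR n / khinchineA (2 * (n : ℝ) / (n + 1)) ^ ((n : ℝ) - 1)) ^
        ((n : ℝ) / (2 * n - 1)) := by
  rw [bhConstR, dif_neg (by omega), dif_neg (by omega), dif_neg (by omega), dif_neg (by omega)]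
  have h : (2 * n - 1 - 1) / 2 = n - 1 := by omega
  have h' : (2 * n - 1 + 1) / 2 = n := by omega
  have hc : ((2 * n - 1 : ℕ) : ℝ) = 2 * n - 1 := by
    rw [Nat.cast_sub (by omega)]; push_cast; ring
  have hn' : (3 : ℝ) ≤ n := by exact_mod_cast hn
  have h0 : (n : ℝ) + 1 ≠ 0 := by positivity
  have h1 : (n : ℝ) ≠ 0 := by positivity
  have h2 : 2 * (n : ℝ) - 1 ≠ 0 := by linarith
  rw [h, h', hc]
  have e1 : (2 * (2 * (n : ℝ) - 1) - 2) / (2 * (n : ℝ) - 1 + 1) = (2 * (n : ℝ) - 2) / n := by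
    rw [div_eq_div_iff (by linarith) h1]; ring
  have e2 : (2 * (n : ℝ) - 1 + 1) / 2 = n := by ring
  have e3 : (2 * (n : ℝ) - 1 - 1) / (2 * (2 * (n : ℝ) - 1)) = ((n : ℝ) - 1) / (2 * n - 1) := by
    rw [div_eq_div_iff (by linarith) h2]; ring
  have e4 : (2 * (2 * (n : ℝ) - 1) + 2) / (2 * (n : ℝ) - 1 + 3) = 2 * (n : ℝ) / (n + 1) := by
    rw [div_eq_div_iff (by linarith) h0]; ring
  have e5 : (2 * (n : ℝ) - 1 - 1) / 2 = (n : ℝ) - 1 := by ring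
  have e6 : (2 * (n : ℝ) - 1 + 1) / (2 * (2 * (n : ℝ) - 1)) = (n : ℝ) / (2 * n - 1) := by
    rw [div_eq_div_iff (by linarith) h2]; ring
  rw [e1, e2, e3, e4, e5, e6]

lemma ratio_alg (a b c d x : ℝ) (hx : 2 * x - 1 ≠ 0) :
    (exp a / exp c ^ x / ((exp b / exp d ^ x) ^ ((x - 1) / (2 * x - 1)) *
      (exp a / exp c ^ (x - 1)) ^ (x / (2 * x - 1)))) /
      (exp a / exp b) ^ ((x - 1) / (2 * x - 1))
    = exp (x * (x - 1) / (2 * x - 1) * d - x ^ 2 / (2 * x - 1) * c) := by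
  simp only [← Real.exp_mul, ← Real.exp_sub, ← Real.exp_add]
  congr 1
  have hz : (2 * x - 1) * (2 * x - 1)⁻¹ = 1 := mul_inv_cancel₀ hx
  simp only [div_eq_mul_inv]
  linear_combination (c * x - a) * hz

lemma lim_aux (w p : ℕ → ℝ) (L : ℝ) (hp : Tendsto p atTop (nhds 2))
    (hw : Tendsto (fun n => w n * (p n - 2)) atTop (nhds L)) :
    Tendsto (fun n => w n * Real.log (khinchineA (p n))) atTop
      (nhds (L * deriv (fun p => Real.log (khinchineA p)) 2)) := by
  have hd := (continuousAt_dslope_same.mpr khA_diff).tendsto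
  rw [dslope_same] at hd
  refine (hw.mul (hd.comp hp)).congr fun n => ?_
  have := sub_smul_dslope (fun p => Real.log (khinchineA p)) 2 (p n)
  simp only [smul_eq_mul, khA_two, Real.log_one, sub_zero] at this
  simp only [Function.comp]
  rw [mul_assoc, this]

/-- `(C_{2n}/C_{2n−1}) / (C_n/C_{n−1})^((n−1)/(2n−1))` converges to `1`. -/
theorem bhConstR_even_odd_ratio :
    Tendsto
      (fun n : ℕ =>
        (bhConstR (2 * n) / bhConstR (2 * n - 1)) /
          (bhConstR n / bhConstR (n - 1)) ^ (((n : ℝ) - 1) / (2 * (n : ℝ) - 1)))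
      atTop (nhds 1) := by
  have hinv : Tendsto (fun n : ℕ => (n : ℝ)⁻¹) atTop (nhds 0) := tendsto_inv_atTop_nhds_zero_nat
  have lim {f : ℕ → ℝ} (φ : ℝ → ℝ) {L : ℝ} (hφ : ContinuousAt φ 0) (hL : φ 0 = L)
      (h : ∀ n : ℕ, 3 ≤ n → φ ((n : ℝ)⁻¹) = f n) : Tendsto f atTop (nhds L) := by
    have := hφ.tendsto.comp hinv
    rw [hL] at this
    refine this.congr' ?_
    filter_upwards [eventually_ge_atTop 3] with n hn using h n hn
  have A1 := lim_aux (fun n => (n : ℝ) * (n - 1) / (2 * n - 1)) (fun n => (2 * (n : ℝ) - 2) / n) (-1)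
    (lim (fun t => 2 - 2 * t) (by fun_prop) (by norm_num) (fun n hn => by
      have : (n : ℝ) ≠ 0 := by positivity
      field_simp))
    (lim (fun t => -2 * (1 - t) / (2 - t))
      (ContinuousAt.div (by fun_prop) (by fun_prop) (by norm_num)) (by norm_num) (fun n hn => by
      have hn' : (3 : ℝ) ≤ n := by exact_mod_cast hn
      have : (n : ℝ) ≠ 0 := by positivity
      have h2 : 2 * (n : ℝ) - 1 ≠ 0 := by linarith
      have h3 : 2 - (n : ℝ)⁻¹ ≠ 0 := by
        have : 2 - (n : ℝ)⁻¹ = (2 * n - 1) / n := by field_simp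
        rw [this]; positivity
      field_simp
      ring))
  have A2 := lim_aux (fun n => (n : ℝ) ^ 2 / (2 * n - 1)) (fun n => 2 * (n : ℝ) / (n + 1)) (-1)
    (lim (fun t => 2 / (1 + t)) (ContinuousAt.div (by fun_prop) (by fun_prop) (by norm_num))
      (by norm_num) (fun n hn => by
      have : (n : ℝ) ≠ 0 := by positivity
      field_simp))
    (lim (fun t => -2 / ((2 - t) * (1 + t)))
      (ContinuousAt.div (by fun_prop) (by fun_prop) (by norm_num)) (by norm_num) (fun n hn => by
      have hn' : (3 : ℝ) ≤ n := by exact_mod_cast hn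
      have : (n : ℝ) ≠ 0 := by positivity
      have h2 : 2 * (n : ℝ) - 1 ≠ 0 := by linarith
      have h3 : 2 - (n : ℝ)⁻¹ ≠ 0 := by
        have : 2 - (n : ℝ)⁻¹ = (2 * n - 1) / n := by field_simp
        rw [this]; positivity
      field_simp
      ring))
  have A3 := (A1.sub A2).rexp
  rw [sub_self, Real.exp_zero] at A3
  refine A3.congr' ?_
  filter_upwards [eventually_ge_atTop 3] with n hn
  have hn' : (3 : ℝ) ≤ n := by exact_mod_cast hn
  rw [bh_even n hn, bh_odd n hn]
  have p1 : 0 < khinchineA (2 * (n : ℝ) / (n + 1)) := khA_pos (by positivity)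
  have p2 : 0 < khinchineA ((2 * (n : ℝ) - 2) / n) :=
    khA_pos (div_pos (by linarith) (by linarith))
  have key := ratio_alg (Real.log (bhConstR n)) (Real.log (bhConstR (n - 1)))
    (Real.log (khinchineA (2 * (n : ℝ) / (n + 1))))
    (Real.log (khinchineA ((2 * (n : ℝ) - 2) / n))) n (by linarith)
  rw [Real.exp_log (bh_pos _), Real.exp_log (bh_pos _), Real.exp_log p1, Real.exp_log p2] at key
  exact key.symm
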